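/- For every fixed integer k ≥ 0, the probability under the uniform distribution U on [M]^N that the image of X misses exactly k elements converges to the Poisson(1) mass: lim_{m→∞} Pr_{X∼U}[ |Im(X)| = M − k ] = 1/(e·k!). -/

import Mathlib

namespace GLN

noncomputable section

open Finset

/-- `M = 2^m`. -/
def MM (m : ℕ) : ℕ := 2 ^ m

/-- `N = ⌈M · m · ln 2⌉`. -/
def NN (m : ℕ) : ℕ := ⌈(MM m : ℝ) * m * Real.log 2⌉₊

/-- Strings `X ∈ [M]^N`. -/
abbrev Str (m : ℕ) := Fin (NN m) → Fin (MM m)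

/-- The uniform probability mass function on `[M]^N`. -/
def umass (m : ℕ) (_X : Str m) : ℝ := 1 / (MM m : ℝ) ^ NN m

/-- The image `Im(X) ⊆ [M]` of a string, as a finset. -/
def img {m : ℕ} (X : Str m) : Finset (Fin (MM m)) := Finset.image X Finset.univ

/-- Transition kernel of `D_y(X)`: each coordinate with `x_i = y` is replaced by a uniform
independent sample from `[M] \ {y}`; other coordinates are unchanged. -/
def kerDy (m : ℕ) (y : Fin (MM m)) (X Z : Str m) : ℝ :=
  ∏ i, if X i = y then (if Z i = y then 0 else 1 / ((MM m : ℝ) - 1))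
       else (if Z i = X i then 1 else 0)

/-- Transition kernel of `D(X)`: choose `y` uniformly in `[M]`, then apply `D_y`. -/
def kerD (m : ℕ) (X Z : Str m) : ℝ := (1 / (MM m : ℝ)) * ∑ y, kerDy m y X Z

/-- The probability mass function of the distribution `D = D(U)`. -/
def dmass (m : ℕ) (Z : Str m) : ℝ := ∑ X, umass m X * kerD m X Z

/-- Transition kernel of `D_y^inv(Z)`: each coordinate is independently replaced by `y`
with probability `1/M` and left unchanged otherwise. -/
def kerDinvy (m : ℕ) (y : Fin (MM m)) (Z W : Str m) : ℝ :=
  ∏ i, ((1 / (MM m : ℝ)) * (if W i = y then 1 else 0)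
        + (1 - 1 / (MM m : ℝ)) * (if W i = Z i then 1 else 0))

/-- Transition kernel of `D^inv(Z)`: choose `y` uniformly in `[M] \ Im(Z)`,
then apply `D_y^inv`. -/
def kerDinv (m : ℕ) (Z W : Str m) : ℝ :=
  (1 / (((img Z)ᶜ.card : ℝ))) * ∑ y ∈ (img Z)ᶜ, kerDinvy m y Z W

/-- Probability of an event under a mass function. -/
def pr {m : ℕ} (μ : Str m → ℝ) (E : Set (Str m)) : ℝ := ∑ X, E.indicator μ X

/-- Expectation of a real function under a mass function. -/
def ev {m : ℕ} (μ : Str m → ℝ) (g : Str m → ℝ) : ℝ := ∑ X, μ X * g X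

/-- The surjectivity function `f_Surj`. -/
def fSurjB (m : ℕ) (X : Str m) : Bool := decide (img X = Finset.univ)

/-- The `q.2`-th bit of the binary encoding of coordinate `x_{q.1}` of `X`;
this realizes `X` as a string of `n = N·m` bits. -/
def bit {m : ℕ} (X : Str m) (q : Fin (NN m) × Fin m) : Bool :=
  Nat.testBit (X q.1).val q.2.val

theorem aux_ident (k w M : ℕ) (hw : w ≤ M) :
    ∑ j ∈ Finset.range (M + 1), (-1 : ℤ) ^ (j + k) * (j.choose k : ℤ) * (w.choose j : ℤ)
      = if w = k then 1 else 0 := by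
  have h1 : ∑ j ∈ Finset.range (M + 1), (-1 : ℤ) ^ (j + k) * (j.choose k : ℤ) * (w.choose j : ℤ)
      = ∑ j ∈ Finset.range (w + 1), (-1 : ℤ) ^ (j + k) * (j.choose k : ℤ) * (w.choose j : ℤ) := by
    symm
    apply Finset.sum_subset
    · intro x hx
      simp only [Finset.mem_range] at *
      omega
    · intro x _ hx
      simp only [Finset.mem_range] at hx
      rw [Nat.choose_eq_zero_of_lt (by omega : w < x)]
      simp
  rw [h1]
  rcases lt_or_ge w k with h | h
  · rw [if_neg (by omega)]
    apply Finset.sum_eq_zero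
    intro j hj
    simp only [Finset.mem_range] at hj
    rw [Nat.choose_eq_zero_of_lt (by omega : j < k)]
    simp
  · obtain ⟨d, rfl⟩ := Nat.exists_eq_add_of_le h
    rw [show k + d + 1 = k + (d + 1) by ring, Finset.sum_range_add]
    rw [Finset.sum_eq_zero (s := Finset.range k)]
    · have h2 : ∀ i ∈ Finset.range (d + 1),
          (-1 : ℤ) ^ (k + i + k) * ((k + i).choose k : ℤ) * ((k + d).choose (k + i) : ℤ)
          = ((k + d).choose k : ℤ) * ((-1) ^ i * (d.choose i : ℤ)) := by
        intro i hi
        simp only [Finset.mem_range] at hi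
        have := Nat.choose_mul (n := k + d) (k := k + i) (s := k) (by omega)
        rw [Nat.add_sub_cancel_left, Nat.add_sub_cancel_left] at this
        have h3 : ((k + d).choose (k + i) : ℤ) * ((k + i).choose k : ℤ)
            = ((k + d).choose k : ℤ) * (d.choose i : ℤ) := by exact_mod_cast this
        have h4 : (-1 : ℤ) ^ (k + i + k) = (-1) ^ i := by
          rw [show k + i + k = 2 * k + i by ring, pow_add, pow_mul]
          simp
        rw [h4]
        linear_combination (-1) ^ i * h3
      rw [Finset.sum_congr rfl h2, ← Finset.mul_sum, Int.alternating_sum_range_choose]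
      rcases Nat.eq_zero_or_pos d with rfl | hd
      · simp
      · rw [if_neg (by omega), if_neg (by omega)]
        simp
    · intro j hj
      simp only [Finset.mem_range] at hj
      rw [Nat.choose_eq_zero_of_lt hj]
      simp

theorem aux_count (N M j : ℕ) :
    ∑ X : Fin N → Fin M, (((Finset.image X Finset.univ)ᶜ.card).choose j)
      = M.choose j * (M - j) ^ N := by
  have h1 : ∀ X : Fin N → Fin M, ((Finset.image X Finset.univ)ᶜ.card).choose j
      = ∑ S ∈ Finset.powersetCard j (Finset.univ : Finset (Fin M)),
          if ∀ i, X i ∈ Sᶜ then 1 else 0 := by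
    intro X
    rw [← Finset.card_powersetCard, ← Finset.card_filter]
    congr 1
    ext S
    simp only [Finset.mem_powersetCard, Finset.mem_filter, Finset.subset_univ, true_and,
      Finset.mem_compl]
    rw [and_comm]
    apply and_congr_right
    intro _
    constructor
    · intro h i hi
      have := h hi
      simp at this
    · intro h x hx
      simp only [Finset.mem_compl, Finset.mem_image, Finset.mem_univ, true_and, not_exists]
      rintro i rfl
      exact h i hx
  simp_rw [h1]
  rw [Finset.sum_comm]
  have h2 : ∀ S ∈ Finset.powersetCard j (Finset.univ : Finset (Fin M)),
      (∑ X : Fin N → Fin M, if ∀ i, X i ∈ Sᶜ then 1 else 0) = (M - j) ^ N := by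
    intro S hS
    rw [Finset.mem_powersetCard] at hS
    rw [← Finset.card_filter]
    have : (Finset.univ.filter fun X : Fin N → Fin M => ∀ i, X i ∈ Sᶜ)
        = Fintype.piFinset (fun _ => Sᶜ) := by
      ext X
      simp [Fintype.mem_piFinset]
    rw [this, Fintype.card_piFinset]
    simp [Finset.card_compl, hS.2]
  rw [Finset.sum_congr rfl h2]
  simp

/-- The `j`-th term. -/
def trm (m j : ℕ) : ℝ :=
  ((MM m).choose j : ℝ) * ((MM m - j : ℕ) : ℝ) ^ NN m / (MM m : ℝ) ^ NN m

theorem aux_pr (k m : ℕ) (hk : k ≤ MM m) :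
    pr (umass m) {X : Str m | (img X).card = MM m - k}
      = ∑' j, (-1 : ℝ) ^ (j + k) * (j.choose k : ℝ) * trm m j := by
  rw [tsum_eq_sum (s := Finset.range (MM m + 1))]
  · have h1 : ∀ X : Str m, Set.indicator {X : Str m | (img X).card = MM m - k} (umass m) X
        = ∑ j ∈ Finset.range (MM m + 1), (-1 : ℝ) ^ (j + k) * (j.choose k : ℝ)
          * (((Finset.image X Finset.univ)ᶜ.card.choose j : ℕ) : ℝ) * (1 / (MM m : ℝ) ^ NN m) := by
      intro X
      have hc : (Finset.image X Finset.univ)ᶜ.card ≤ MM m := by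
        simpa using Finset.card_le_univ (Finset.image X Finset.univ)ᶜ
      have hs : (img X).card + (Finset.image X Finset.univ)ᶜ.card = MM m := by
        simpa [img] using Finset.card_add_card_compl (Finset.image X Finset.univ)
      have := congrArg (Int.cast : ℤ → ℝ) (aux_ident k _ (MM m) hc)
      push_cast at this
      rw [← Finset.sum_mul, this]
      by_cases h : (Finset.image X Finset.univ)ᶜ.card = k
      · rw [Set.indicator_of_mem (by simp only [Set.mem_ofPred_eq]; omega), if_pos h]
        simp [umass]
      · rw [Set.indicator_of_notMem (by simp only [Set.mem_ofPred_eq]; omega), if_neg h]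
        simp
    unfold pr
    rw [Finset.sum_congr rfl (fun X _ => h1 X), Finset.sum_comm]
    apply Finset.sum_congr rfl
    intro j _
    rw [← Finset.sum_mul, ← Finset.mul_sum, ← Nat.cast_sum, aux_count]
    unfold trm
    push_cast
    ring
  · intro j hj
    simp only [Finset.mem_range] at hj
    unfold trm
    rw [Nat.choose_eq_zero_of_lt (by omega : MM m < j)]
    simp

theorem MM_pos (m : ℕ) : (0 : ℝ) < MM m := by
  unfold MM; positivity

theorem log_MM (m : ℕ) : Real.log (MM m) = m * Real.log 2 := by
  unfold MM; push_cast; rw [Real.log_pow]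

theorem NN_ge (m : ℕ) : (MM m : ℝ) * Real.log (MM m) ≤ NN m := by
  rw [log_MM, ← mul_assoc]; exact Nat.le_ceil _

theorem NN_le (m : ℕ) : (NN m : ℝ) ≤ (MM m : ℝ) * Real.log (MM m) + 1 := by
  rw [log_MM, ← mul_assoc]
  refine (Nat.ceil_lt_add_one ?_).le
  have := Real.log_nonneg (show (1 : ℝ) ≤ 2 by norm_num)
  positivity

/-- `M^j (1-j/M)^N`. -/
def fac (m j : ℕ) : ℝ := (MM m : ℝ) ^ j * (((MM m - j : ℕ) : ℝ) / MM m) ^ NN m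

theorem trm_eq (m j : ℕ) : trm m j = ((MM m).choose j : ℝ) / (MM m : ℝ) ^ j * fac m j := by
  have := MM_pos m
  unfold trm fac
  rw [div_pow]
  field_simp

theorem fac_nonneg (m j : ℕ) : 0 ≤ fac m j := by unfold fac; positivity

theorem fac_le (m j : ℕ) (hj : j ≤ MM m) : fac m j ≤ 1 := by
  have hM := MM_pos m
  have h1 : ((MM m - j : ℕ) : ℝ) / MM m ≤ Real.exp (-(j / MM m)) := by
    have := Real.add_one_le_exp (-((j : ℝ) / MM m))
    rw [Nat.cast_sub hj, sub_div, div_self hM.ne']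
    linarith
  have h2 : (((MM m - j : ℕ) : ℝ) / MM m) ^ NN m ≤ Real.exp (-(j * Real.log (MM m))) := by
    calc _ ≤ Real.exp (-(j / MM m)) ^ NN m := by gcongr
      _ = Real.exp (NN m * (-(j / MM m))) := by rw [← Real.exp_nat_mul]
      _ ≤ _ := by
        apply Real.exp_le_exp.2
        have := mul_le_mul_of_nonneg_left (NN_ge m) (show 0 ≤ (j : ℝ) / MM m by positivity)
        have h3 : (j : ℝ) / MM m * (MM m * Real.log (MM m)) = j * Real.log (MM m) := by
          field_simp
        linarith
  have h4 : (MM m : ℝ) ^ j = Real.exp (j * Real.log (MM m)) := by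
    rw [Real.exp_nat_mul, Real.exp_log hM]
  unfold fac
  calc _ ≤ (MM m : ℝ) ^ j * Real.exp (-(j * Real.log (MM m))) := by gcongr
    _ = 1 := by rw [h4, ← Real.exp_add]; simp

theorem fac_ge (m j : ℕ) (hj : j < MM m) :
    Real.exp (-(j * (1 + j * Real.log (MM m)) / (MM m - j))) ≤ fac m j := by
  have hM := MM_pos m
  have hd : (0 : ℝ) < (MM m : ℝ) - j := by
    have : (j : ℝ) < MM m := by exact_mod_cast hj
    linarith
  have hq : (0 : ℝ) < ((MM m : ℝ) - j) / MM m := by positivity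
  have h4 : (MM m : ℝ) ^ j = Real.exp (j * Real.log (MM m)) := by
    rw [Real.exp_nat_mul, Real.exp_log hM]
  unfold fac
  rw [Nat.cast_sub hj.le, h4]
  nth_rewrite 1 [← Real.exp_log hq]
  rw [← Real.exp_nat_mul, ← Real.exp_add]
  apply Real.exp_le_exp.2
  have h5 := Real.one_sub_inv_le_log_of_pos hq
  have h6 : 1 - (((MM m : ℝ) - j) / MM m)⁻¹ = -(j / (MM m - j)) := by
    field_simp; ring
  rw [h6] at h5
  have h7 := mul_le_mul_of_nonneg_left h5 (show (0 : ℝ) ≤ NN m by positivity)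
  have h8 := mul_le_mul_of_nonneg_right (NN_le m) (show (0 : ℝ) ≤ j / (MM m - j) by positivity)
  have h9 : (MM m * Real.log (MM m) + 1) * ((j : ℝ) / (MM m - j))
     = j * Real.log (MM m) + j * (1 + j * Real.log (MM m)) / (MM m - j) := by
    field_simp; ring
  linarith

theorem MM_tendsto_nat : Filter.Tendsto MM Filter.atTop Filter.atTop :=
  tendsto_pow_atTop_atTop_of_one_lt (by norm_num : 1 < 2)

theorem MM_tendsto : Filter.Tendsto (fun m => (MM m : ℝ)) Filter.atTop Filter.atTop :=
  tendsto_natCast_atTop_atTop.comp MM_tendsto_nat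

theorem fac_tendsto (j : ℕ) : Filter.Tendsto (fun m => fac m j) Filter.atTop (nhds 1) := by
  have hlog : Filter.Tendsto (fun x : ℝ => Real.log x / x) Filter.atTop (nhds 0) :=
    Real.isLittleO_log_id_atTop.tendsto_div_nhds_zero
  have hinv : Filter.Tendsto (fun x : ℝ => x⁻¹) Filter.atTop (nhds 0) := tendsto_inv_atTop_zero
  have h0 : Filter.Tendsto (fun x : ℝ =>
      Real.exp (-(j * (x⁻¹ + j * (Real.log x / x)) / (1 - j * x⁻¹)))) Filter.atTop
      (nhds (Real.exp (-(j * (0 + j * 0) / (1 - j * 0))))) := by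
    refine (Real.continuous_exp.tendsto _).comp (Filter.Tendsto.neg ?_)
    refine Filter.Tendsto.div ?_ ?_ (by simp)
    · exact (hinv.add (hlog.const_mul _)).const_mul _
    · exact (hinv.const_mul _).const_sub _
  have h1 := h0.comp MM_tendsto
  simp only [mul_zero, add_zero, zero_div, neg_zero, Real.exp_zero] at h1
  refine tendsto_of_tendsto_of_tendsto_of_le_of_le' h1 tendsto_const_nhds ?_ ?_
  · filter_upwards [MM_tendsto_nat.eventually_gt_atTop j] with m hm
    refine le_trans (le_of_eq ?_) (fac_ge m j hm)
    have hM := MM_pos m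
    have hd : (0 : ℝ) < (MM m : ℝ) - j := by
      have : (j : ℝ) < MM m := by exact_mod_cast hm
      linarith
    have hd' : (1 : ℝ) - j * (MM m : ℝ)⁻¹ = (MM m - j) / MM m := by field_simp
    simp only [Function.comp]
    rw [hd']
    congr 2
    field_simp
  · filter_upwards [MM_tendsto_nat.eventually_ge_atTop j] with m hm
    exact fac_le m j hm

theorem trm_nonneg (m j : ℕ) : 0 ≤ trm m j := by unfold trm; positivity

theorem trm_le (m j : ℕ) : trm m j ≤ 1 / (j.factorial : ℝ) := by
  have hM := MM_pos m
  rcases le_or_gt j (MM m) with h | h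
  · rw [trm_eq]
    have h1 : ((MM m).choose j : ℝ) / (MM m : ℝ) ^ j ≤ 1 / (j.factorial : ℝ) := by
      rw [div_le_iff₀ (by positivity)]
      have := Nat.choose_le_pow_div (α := ℝ) j (MM m)
      rw [one_div_mul_eq_div]
      exact this
    calc _ ≤ 1 / (j.factorial : ℝ) * 1 := by
            gcongr
            · exact fac_nonneg _ _
            · exact fac_le m j h
      _ = _ := mul_one _
  · unfold trm
    rw [Nat.choose_eq_zero_of_lt h]
    simp

open Asymptotics in
theorem trm_tendsto (j : ℕ) :
    Filter.Tendsto (fun m => trm m j) Filter.atTop (nhds (1 / (j.factorial : ℝ))) := by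
  have h : Filter.Tendsto (fun n : ℕ => (n.choose j : ℝ) / (n : ℝ) ^ j) Filter.atTop
      (nhds (1 / (j.factorial : ℝ))) := by
    have h1 := (isEquivalent_choose (j))
    have h2 : (fun n : ℕ => (n.choose j : ℝ) / (n : ℝ) ^ j) ~[Filter.atTop]
        (fun n : ℕ => ((n : ℝ) ^ j / (j.factorial : ℝ)) / (n : ℝ) ^ j) := h1.div .refl
    refine (h2.symm.tendsto_nhds ?_)
    refine tendsto_const_nhds.congr' ?_
    filter_upwards [Filter.eventually_gt_atTop 0] with n hn
    have : (0 : ℝ) < n := by exact_mod_cast hn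
    field_simp
  have := (h.comp MM_tendsto_nat).mul (fac_tendsto j)
  rw [mul_one] at this
  exact this.congr (fun m => (trm_eq m j).symm)

theorem aux_sum (k : ℕ) : ∑' j, (-1 : ℝ) ^ (j + k) * (j.choose k : ℝ) * (1 / (j.factorial : ℝ))
    = 1 / (Real.exp 1 * (Nat.factorial k : ℝ)) := by
  have h0 : ∀ i : ℕ, (-1 : ℝ) ^ (i + k + k) * ((i + k).choose k : ℝ) * (1 / ((i + k).factorial : ℝ))
      = (1 / (k.factorial : ℝ)) * ((-1) ^ i / i.factorial) := by
    intro i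
    have h4 : (-1 : ℝ) ^ (i + k + k) = (-1) ^ i := by
      rw [show i + k + k = 2 * k + i by ring, pow_add, pow_mul]
      simp
    rw [h4]
    have h5 : (((i + k).choose k : ℕ) : ℝ) * i.factorial * k.factorial = (i + k).factorial := by
      have h6 := Nat.choose_mul_factorial_mul_factorial (Nat.le_add_left k i)
      rw [Nat.add_sub_cancel] at h6
      rw [← h6]
      push_cast
      ring
    have : (((i + k).factorial : ℕ) : ℝ) ≠ 0 := by positivity
    field_simp
    linarith
  have h1 : HasSum (fun i : ℕ => (1 / (k.factorial : ℝ)) * ((-1 : ℝ) ^ i / i.factorial))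
      ((1 / (k.factorial : ℝ)) * Real.exp (-1)) := by
    refine HasSum.mul_left _ ?_
    rw [Real.exp_eq_exp_ℝ]
    exact NormedSpace.expSeries_div_hasSum_exp (-1 : ℝ)
  have h2 : HasSum (fun i : ℕ =>
      (-1 : ℝ) ^ (i + k + k) * ((i + k).choose k : ℝ) * (1 / ((i + k).factorial : ℝ)))
      ((1 / (k.factorial : ℝ)) * Real.exp (-1)) := by
    simpa only [h0] using h1
  have h3 := (hasSum_nat_add_iff (f := fun j : ℕ =>
    (-1 : ℝ) ^ (j + k) * (j.choose k : ℝ) * (1 / (j.factorial : ℝ))) k).1 h2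
  rw [Finset.sum_eq_zero, add_zero] at h3
  · rw [h3.tsum_eq, Real.exp_neg]
    field_simp
  · intro j hj
    simp only [Finset.mem_range] at hj
    rw [Nat.choose_eq_zero_of_lt hj]
    simp

/-- for every fixed `k ≥ 0`,
`Pr_{X∼U}[|Im(X)| = M − k] → 1/(e·k!)` as `m → ∞`. -/
theorem stmt8 (k : ℕ) :
    Filter.Tendsto (fun m : ℕ => pr (umass m) {X : Str m | (img X).card = MM m - k})
      Filter.atTop (nhds (1 / (Real.exp 1 * (Nat.factorial k : ℝ)))) := by
  rw [← aux_sum]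
  have h : Filter.Tendsto (fun m => ∑' j, (-1 : ℝ) ^ (j + k) * (j.choose k : ℝ) * trm m j)
      Filter.atTop
      (nhds (∑' j, (-1 : ℝ) ^ (j + k) * (j.choose k : ℝ) * (1 / (j.factorial : ℝ)))) := by
    refine tendsto_tsum_of_dominated_convergence
      (bound := fun j : ℕ => (2 : ℝ) ^ j / j.factorial) ?_ ?_ ?_
    · exact Real.summable_pow_div_factorial 2
    · intro j
      exact (trm_tendsto j).const_mul _
    · refine Filter.Eventually.of_forall fun m j => ?_
      rw [norm_mul, norm_mul, norm_pow, norm_neg, norm_one, one_pow, one_mul,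
        Real.norm_of_nonneg (by positivity), Real.norm_of_nonneg (trm_nonneg m j)]
      have h1 : (j.choose k : ℝ) ≤ 2 ^ j := by exact_mod_cast Nat.choose_le_two_pow j k
      calc _ ≤ (2 : ℝ) ^ j * (1 / j.factorial) := by
            gcongr
            · exact trm_nonneg m j
            · exact trm_le m j
        _ = _ := by ring
  refine h.congr' ?_
  filter_upwards [MM_tendsto_nat.eventually_ge_atTop k] with m hm
  exact (aux_pr k m hm).symm

end
end GLN
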